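/- Let erfc(z) := (2/√π) ∫_z^∞ e^{−u²} du, Φ(s, w) := Σ_{k∈ℤ} sgn(2k + w) erfc(|2k + w|/(2√s)), and φ(s, w) := (4πs³)^{−1/2} Σ_{k∈ℤ} (w + 2k) e^{−(w+2k)²/(4s)} for s > 0, w ∈ (0,1). Fix D > 0, l > 0, x_0 ∈ (0, l/2); set F(t) := Φ(Dt/l², x_0/l) + Φ(Dt/l², 1 − x_0/l) and f_1(t) := (D/l²) φ(Dt/l², 1 − x_0/l). Then N ∫_0^∞ (1 − F(t))^{N−1} f_1(t) dt ∼ η (ln N)^{(β−1)/2} N^{1−β} as N → ∞, where β = ((l − x_0)/x_0)² > 1 and η = √(β π^{β−1}) Γ(β) > 0. -/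

import Mathlib

open MeasureTheory Filter Set Real
open scoped Topology

/-- The complementary error function `erfc z = (2/√π) ∫_z^∞ e^{-u²} du`. -/
noncomputable def erfc (z : ℝ) : ℝ :=
  (2 / Real.sqrt Real.pi) * ∫ u in Set.Ioi z, Real.exp (-u ^ 2)

/-- `Φ(s,w) = Σ_{k∈ℤ} sgn(2k+w) erfc(|2k+w|/(2√s))`. -/
noncomputable def PhiShort (s w : ℝ) : ℝ :=
  ∑' k : ℤ, Real.sign (2 * (k : ℝ) + w) * erfc (|2 * (k : ℝ) + w| / (2 * Real.sqrt s))

/-- `φ(s,w) = (4πs³)^{-1/2} Σ_{k∈ℤ} (w+2k) e^{-(w+2k)²/(4s)}`. -/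
noncomputable def phiDens (s w : ℝ) : ℝ :=
  (Real.sqrt (4 * Real.pi * s ^ 3))⁻¹ *
    ∑' k : ℤ, (w + 2 * (k : ℝ)) * Real.exp (-(w + 2 * (k : ℝ)) ^ 2 / (4 * s))


lemma erfc_integrable : Integrable (fun u : ℝ => Real.exp (-u ^ 2)) := by
  simpa using integrable_exp_neg_mul_sq (b := 1) one_pos

lemma erfc_hasDerivAt (z : ℝ) : HasDerivAt erfc (-(2 / √π * Real.exp (-z ^ 2))) z := by
  have h : erfc = fun z => (2 / √π) * ((∫ u in Set.Ioi (0:ℝ), Real.exp (-u ^ 2))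
      - ∫ u in (0:ℝ)..z, Real.exp (-u ^ 2)) := by
    funext z
    unfold erfc
    rw [← intervalIntegral.integral_Ioi_sub_Ioi' erfc_integrable.integrableOn
      erfc_integrable.integrableOn]
    ring
  rw [h]
  have h2 : HasDerivAt (fun z => ∫ u in (0:ℝ)..z, Real.exp (-u ^ 2)) (Real.exp (-z ^ 2)) z :=
    (Continuous.integral_hasStrictDerivAt (by fun_prop) 0 z).hasDerivAt
  have := (h2.const_sub (∫ u in Set.Ioi (0:ℝ), Real.exp (-u ^ 2))).const_mul (2 / √π)
  exact this.congr_deriv (by ring)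

lemma erfc_continuous : Continuous erfc :=
  continuous_iff_continuousAt.2 fun z => (erfc_hasDerivAt z).continuousAt

lemma erfc_nonneg (z : ℝ) : 0 ≤ erfc z :=
  mul_nonneg (by positivity) (setIntegral_nonneg measurableSet_Ioi fun u _ => (Real.exp_pos _).le)

lemma erfc_strictAnti : StrictAnti erfc := by
  apply strictAnti_of_deriv_neg
  intro x
  rw [(erfc_hasDerivAt x).deriv]
  have : 0 < √π := by positivity
  have := Real.exp_pos (-x ^ 2)
  have : 0 < 2 / √π * Real.exp (-x ^ 2) := by positivity
  linarith

lemma erfc_pos (z : ℝ) : 0 < erfc z :=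
  lt_of_le_of_lt (erfc_nonneg (z+1)) (erfc_strictAnti (by linarith))

lemma erfc_zero : erfc 0 = 1 := by
  unfold erfc
  have := integral_gaussian_Ioi 1
  simp only [neg_mul, one_mul, div_one] at this
  rw [this]
  have : √π ≠ 0 := by positivity
  field_simp

lemma erfc_convex : ConvexOn ℝ (Ici 0) erfc := by
  apply MonotoneOn.convexOn_of_deriv (convex_Ici 0) erfc_continuous.continuousOn
    (fun x _ => (erfc_hasDerivAt x).differentiableAt.differentiableWithinAt)
  intro x hx y hy hxy
  simp only [interior_Ici, mem_Ioi] at hx hy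
  rw [(erfc_hasDerivAt x).deriv, (erfc_hasDerivAt y).deriv]
  have : Real.exp (-y ^ 2) ≤ Real.exp (-x ^ 2) := Real.exp_le_exp.2 (by nlinarith)
  have h2 : 0 ≤ 2 / √π := by positivity
  nlinarith [mul_le_mul_of_nonneg_left this h2]

lemma erfc_aux (x : ℝ) (hx : 0 < x) :
    IntegrableOn (fun u : ℝ => Real.exp (-u ^ 2) * (1 + 1 / (2 * u ^ 2))) (Ioi x) ∧
    ∫ u in Ioi x, Real.exp (-u ^ 2) * (1 + 1 / (2 * u ^ 2)) = Real.exp (-x ^ 2) / (2 * x) := by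
  have hd : ∀ u ∈ Ici x, HasDerivAt (fun u : ℝ => -(Real.exp (-u ^ 2) / (2 * u)))
      (Real.exp (-u ^ 2) * (1 + 1 / (2 * u ^ 2))) u := by
    intro u hu
    have hu0 : u ≠ 0 := (lt_of_lt_of_le hx hu).ne'
    have h1 : HasDerivAt (fun u : ℝ => Real.exp (-u ^ 2)) (Real.exp (-u ^ 2) * (-(2 * u))) u := by
      have : HasDerivAt (fun u : ℝ => -u ^ 2) (-(2 * u)) u := by
        exact (hasDerivAt_pow 2 u).neg.congr_deriv (by simp)
      exact this.exp
    have h2 : HasDerivAt (fun u : ℝ => 2 * u) 2 u := by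
      simpa using (hasDerivAt_id u).const_mul 2
    refine (h1.div h2 (by positivity)).neg.congr_deriv ?_
    field_simp
    ring
  have hp : ∀ u ∈ Ioi x, 0 ≤ Real.exp (-u ^ 2) * (1 + 1 / (2 * u ^ 2)) := by
    intro u hu
    positivity
  have ht : Tendsto (fun u : ℝ => -(Real.exp (-u ^ 2) / (2 * u))) atTop (𝓝 0) := by
    have h1 : Tendsto (fun u : ℝ => Real.exp (-u ^ 2)) atTop (𝓝 0) :=
      Real.tendsto_exp_neg_atTop_nhds_zero.comp (tendsto_pow_atTop two_ne_zero)
    have h2 : Tendsto (fun u : ℝ => 2 * u) atTop atTop :=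
      Tendsto.const_mul_atTop two_pos tendsto_id
    simpa using (h1.div_atTop h2).neg
  refine ⟨integrableOn_Ioi_deriv_of_nonneg' hd hp ht, ?_⟩
  rw [integral_Ioi_of_hasDerivAt_of_nonneg' hd hp ht]
  ring

lemma erfc_le (x : ℝ) (hx : 0 < x) : √π * x * Real.exp (x ^ 2) * erfc x ≤ 1 := by
  obtain ⟨h1, h2⟩ := erfc_aux x hx
  have h3 : ∫ u in Ioi x, Real.exp (-u ^ 2) ≤ Real.exp (-x ^ 2) / (2 * x) := by
    rw [← h2]
    apply setIntegral_mono_on erfc_integrable.integrableOn h1 measurableSet_Ioi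
    intro u hu
    have : 0 ≤ 1 / (2 * u ^ 2) := by positivity
    nlinarith [Real.exp_pos (-u ^ 2)]
  unfold erfc
  have hp : √π ≠ 0 := by positivity
  calc √π * x * Real.exp (x ^ 2) * (2 / √π * ∫ u in Ioi x, Real.exp (-u ^ 2))
      = 2 * x * Real.exp (x ^ 2) * ∫ u in Ioi x, Real.exp (-u ^ 2) := by field_simp
    _ ≤ 2 * x * Real.exp (x ^ 2) * (Real.exp (-x ^ 2) / (2 * x)) := by gcongr
    _ = 1 := by
      rw [Real.exp_neg]
      have := Real.exp_pos (x ^ 2)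
      field_simp

lemma erfc_ge (x : ℝ) (hx : 0 < x) :
    (1 + 1 / (2 * x ^ 2))⁻¹ ≤ √π * x * Real.exp (x ^ 2) * erfc x := by
  obtain ⟨h1, h2⟩ := erfc_aux x hx
  have h3 : Real.exp (-x ^ 2) / (2 * x) ≤
      (1 + 1 / (2 * x ^ 2)) * ∫ u in Ioi x, Real.exp (-u ^ 2) := by
    rw [← h2, ← integral_const_mul]
    apply setIntegral_mono_on h1 (erfc_integrable.integrableOn.const_mul _) measurableSet_Ioi
    intro u hu
    rw [mul_comm]
    have hu : x < u := hu
    gcongr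
  unfold erfc
  have hp : √π ≠ 0 := by positivity
  have hq : 0 < 1 + 1 / (2 * x ^ 2) := by positivity
  rw [inv_le_iff_one_le_mul₀' hq]
  calc 1 = 2 * x * Real.exp (x ^ 2) * (Real.exp (-x ^ 2) / (2 * x)) := by
        rw [Real.exp_neg]
        have := Real.exp_pos (x ^ 2)
        field_simp
    _ ≤ 2 * x * Real.exp (x ^ 2) *
        ((1 + 1 / (2 * x ^ 2)) * ∫ u in Ioi x, Real.exp (-u ^ 2)) := by gcongr
    _ = _ := by field_simp

lemma erfc_tendsto : Tendsto (fun x => √π * x * Real.exp (x ^ 2) * erfc x) atTop (𝓝 1) := by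
  have h : Tendsto (fun x : ℝ => (1 + 1 / (2 * x ^ 2))⁻¹) atTop (𝓝 1) := by
    have : Tendsto (fun x : ℝ => 2 * x ^ 2) atTop atTop :=
      Tendsto.const_mul_atTop two_pos (tendsto_pow_atTop two_ne_zero)
    have := (tendsto_const_nhds (x := (1:ℝ))).add ((tendsto_const_nhds (x := (1:ℝ))).div_atTop this)
    simpa using this.inv₀ (by norm_num)
  refine tendsto_of_tendsto_of_tendsto_of_le_of_le' h tendsto_const_nhds ?_ ?_
  · filter_upwards [eventually_gt_atTop 0] with x hx using erfc_ge x hx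
  · filter_upwards [eventually_gt_atTop 0] with x hx using erfc_le x hx

lemma erfc_tendsto_mul (κ : ℝ) (hκ : 1 < κ) :
    Tendsto (fun x => √π * x * Real.exp (x ^ 2) * erfc (κ * x)) atTop (𝓝 0) := by
  have h : Tendsto (fun x : ℝ => Real.exp (-((κ ^ 2 - 1) * x ^ 2))) atTop (𝓝 0) :=
    Real.tendsto_exp_neg_atTop_nhds_zero.comp
      (Tendsto.const_mul_atTop (by nlinarith) (tendsto_pow_atTop two_ne_zero))
  refine tendsto_of_tendsto_of_tendsto_of_le_of_le' tendsto_const_nhds h ?_ ?_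
  · filter_upwards [eventually_gt_atTop 0] with x hx
    have := erfc_nonneg (κ * x)
    positivity
  · filter_upwards [eventually_gt_atTop 0] with x hx
    have h1 := erfc_le (κ * x) (by positivity)
    have h0 := erfc_nonneg (κ * x)
    calc √π * x * Real.exp (x ^ 2) * erfc (κ * x)
        ≤ √π * (κ * x) * Real.exp (x ^ 2) * erfc (κ * x) := by
          gcongr; nlinarith
      _ = Real.exp (-((κ ^ 2 - 1) * x ^ 2)) *
          (√π * (κ * x) * Real.exp ((κ * x) ^ 2) * erfc (κ * x)) := by
          have : Real.exp (x ^ 2) =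
            Real.exp (-((κ ^ 2 - 1) * x ^ 2)) * Real.exp ((κ * x) ^ 2) := by
            rw [← Real.exp_add]; congr 1; ring
          rw [this]; ring
      _ ≤ Real.exp (-((κ ^ 2 - 1) * x ^ 2)) * 1 := by gcongr
      _ = _ := mul_one _

lemma erfc_summable (a b : ℝ) (ha : 0 < a) (hb : 0 ≤ b) :
    Summable (fun k : ℕ => erfc (a * k + b)) := by
  have hs : Summable (fun k : ℕ => Real.exp (-a) ^ k) :=
    summable_geometric_of_lt_one (Real.exp_pos _).le (by simpa using ha)
  have : (fun k : ℕ => erfc (a * k + b)) =O[atTop] (fun k : ℕ => Real.exp (-a) ^ k) := by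
    apply Asymptotics.IsBigO.of_bound 1
    have hev : ∀ᶠ k : ℕ in atTop, 1 ≤ a * (k:ℝ) :=
      (Tendsto.const_mul_atTop ha tendsto_natCast_atTop_atTop).eventually_ge_atTop 1
    filter_upwards [hev] with k hk
    rw [Real.norm_of_nonneg (erfc_nonneg _), Real.norm_of_nonneg (by positivity), one_mul,
      ← Real.exp_nat_mul]
    set y := a * (k:ℝ)
    have h1 := erfc_le y (by linarith)
    have h2 : erfc (y + b) ≤ erfc y := erfc_strictAnti.antitone (by linarith)
    have h3 : (1:ℝ) ≤ √π := by
      rw [Real.one_le_sqrt]; linarith [Real.pi_gt_three]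
    have h4 : Real.exp y ≤ √π * y * Real.exp (y ^ 2) := by
      calc Real.exp y = 1 * 1 * Real.exp y := by ring
        _ ≤ √π * y * Real.exp (y ^ 2) := by gcongr; nlinarith
    have h5 : Real.exp y * erfc y ≤ 1 :=
      (mul_le_mul_of_nonneg_right h4 (erfc_nonneg y)).trans h1
    have h6 : (k:ℝ) * -a = -y := by simp only [y]; ring
    rw [h6, Real.exp_neg, ← one_div, le_div_iff₀ (Real.exp_pos _)]
    nlinarith [Real.exp_pos y]
  exact summable_of_isBigO_nat hs this

lemma erfc_conv (a b c t : ℝ) (ha : 0 ≤ a) (hb : 0 ≤ b) (ht0 : 0 ≤ t) (ht1 : t ≤ 1)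
    (hc : c = (1 - t) * a + t * b) : erfc c ≤ (1 - t) * erfc a + t * erfc b := by
  have := erfc_convex.2 (mem_Ici.2 ha) (mem_Ici.2 hb) (by linarith : 0 ≤ 1 - t) ht0 (by ring)
  simpa [hc] using this

lemma hasSum_telescope {f : ℕ → ℝ} (hf : Summable f) :
    HasSum (fun k => f k - f (k + 1)) (f 0) := by
  have := hf.hasSum.sub ((hasSum_nat_add_iff' 1).2 hf.hasSum)
  simpa using this

lemma phi_summable (s w : ℝ) (hs : 0 < s) (hw0 : 0 < w) (hw1 : w < 1) :
    Summable (fun k : ℤ => Real.sign (2 * (k : ℝ) + w) *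
      erfc (|2 * (k : ℝ) + w| / (2 * Real.sqrt s))) := by
  have hz : 0 < (2 * √s)⁻¹ := by positivity
  apply Summable.of_nat_of_neg_add_one
  · refine (erfc_summable (2 * (2 * √s)⁻¹) (w * (2 * √s)⁻¹) (by positivity)
      (by positivity)).congr fun k => ?_
    have : 0 < 2 * (((k : ℕ) : ℤ) : ℝ) + w := by push_cast; positivity
    rw [Real.sign_of_pos this, abs_of_pos this, one_mul]
    congr 1; push_cast; ring
  · refine (erfc_summable (2 * (2 * √s)⁻¹) ((2 - w) * (2 * √s)⁻¹) (by positivity)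
      (by have : 0 < 2 - w := by linarith
          positivity)).neg.congr fun k => ?_
    have : 2 * ((-((k : ℕ) + 1 : ℤ) : ℤ) : ℝ) + w < 0 := by
      push_cast
      have : (0:ℝ) ≤ k := by positivity
      linarith
    rw [Real.sign_of_neg this, abs_of_neg this, neg_one_mul]
    congr 2; push_cast; ring

lemma phi_hasSum (s w : ℝ) (hs : 0 < s) (hw0 : 0 < w) (hw1 : w < 1) :
    HasSum (fun k : ℕ => erfc ((2 * k + w) * (2 * √s)⁻¹) - erfc ((2 * k + 2 - w) * (2 * √s)⁻¹))
      (PhiShort s w) := by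
  have h := (phi_summable s w hs hw0 hw1).hasSum.nat_add_neg_add_one
  unfold PhiShort
  refine h.congr_fun fun k => ?_
  have h1 : 0 < 2 * (((k : ℕ) : ℤ) : ℝ) + w := by push_cast; positivity
  have h2 : 2 * ((-((k : ℕ) + 1 : ℤ) : ℤ) : ℝ) + w < 0 := by
    push_cast
    have : (0:ℝ) ≤ k := by positivity
    linarith
  rw [Real.sign_of_pos h1, abs_of_pos h1, one_mul, Real.sign_of_neg h2, abs_of_neg h2, neg_one_mul,
    sub_eq_add_neg]
  congr 2
  congr 1; push_cast; ring

lemma phi_bounds (s w : ℝ) (hs : 0 < s) (hw0 : 0 < w) (hw1 : w < 1) :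
    PhiShort s w ≤ erfc (w * (2 * √s)⁻¹) ∧
    PhiShort s w ≤ (1 - w / (2 - w)) ∧
    (1 - w) * erfc (w * (2 * √s)⁻¹) ≤ PhiShort s w ∧
    erfc (w * (2 * √s)⁻¹) - erfc ((2 - w) * (2 * √s)⁻¹) ≤ PhiShort s w ∧ 0 ≤ PhiShort s w := by
  have H := phi_hasSum s w hs hw0 hw1
  set z := (2 * √s)⁻¹ with hz'
  have hz : 0 < z := by positivity
  have hS : ∀ b : ℝ, 0 ≤ b → Summable (fun k : ℕ => erfc ((2 * k + b) * z)) := by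
    intro b hb
    refine (erfc_summable (2 * z) (b * z) (by positivity) (by positivity)).congr fun k => ?_
    congr 1; ring
  have hT : ∀ b : ℝ, 0 ≤ b → HasSum (fun k : ℕ => erfc ((2 * k + b) * z)
      - erfc ((2 * k + 2 + b) * z)) (erfc (b * z)) := by
    intro b hb
    have := hasSum_telescope (hS b hb)
    simp only [Nat.cast_zero, mul_zero, zero_add] at this
    refine this.congr_fun fun k => ?_
    push_cast
    congr 3; ring
  have hmono : ∀ a b : ℝ, a ≤ b → erfc (b * z) ≤ erfc (a * z) := fun a b hab =>
    erfc_strictAnti.antitone (by gcongr)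
  have hnn : ∀ k : ℕ, 0 ≤ erfc ((2 * k + w) * z) - erfc ((2 * k + 2 - w) * z) := by
    intro k
    have := hmono (2 * k + w) (2 * k + 2 - w) (by linarith)
    linarith
  refine ⟨?_, ?_, ?_, ?_, ?_⟩
  · refine hasSum_le (fun k => ?_) H (hT w hw0.le)
    have := hmono (2 * k + 2 - w) (2 * k + 2 + w) (by linarith)
    linarith
  · have h2 := (hT 0 le_rfl).mul_left (1 - w / (2 - w))
    simp only [zero_mul, erfc_zero, mul_one, add_zero] at h2
    refine hasSum_le (fun k => ?_) H h2
    have hw2 : 0 < 2 - w := by linarith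
    have hk : (0:ℝ) ≤ k := by positivity
    have ht1 : w / (2 - w) ≤ 1 := by rw [div_le_one hw2]; linarith
    have h3 := erfc_conv (2 * k * z) ((2 * k + 2 - w) * z) ((2 * k + w) * z) (w / (2 - w))
      (by positivity) (mul_nonneg (by linarith) hz.le) (by positivity) ht1
      (by field_simp; ring)
    have h4 := hmono (2 * k + 2 - w) (2 * k + 2) (by linarith)
    nlinarith
  · refine hasSum_le (fun k => ?_) ((hT w hw0.le).mul_left (1 - w)) H
    have hk : (0:ℝ) ≤ k := by positivity
    have h3 := erfc_conv ((2 * k + w) * z) ((2 * k + 2 + w) * z) ((2 * k + 2 - w) * z) (1 - w)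
      (by positivity) (by positivity) (by linarith) (by linarith) (by ring)
    nlinarith
  · have := sum_le_hasSum {0} (fun k _ => hnn k) H
    simpa using this
  · exact H.nonneg hnn

lemma phi_meas (w : ℝ) (hw0 : 0 < w) (hw1 : w < 1) :
    Measurable (indicator (Ioi 0) (fun s => PhiShort s w)) := by
  refine measurable_of_tendsto_metrizable' (atTop : Filter (Finset ℤ))
    (f := fun (F : Finset ℤ) => indicator (Ioi 0) (fun s => ∑ k ∈ F, Real.sign (2 * (k : ℝ) + w) *
      erfc (|2 * (k : ℝ) + w| / (2 * Real.sqrt s)))) ?_ ?_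
  · intro F
    refine Measurable.indicator ?_ measurableSet_Ioi
    have := erfc_continuous.measurable
    fun_prop
  · rw [tendsto_pi_nhds]
    intro s
    by_cases hs : s ∈ Ioi (0:ℝ)
    · have := (phi_summable s w hs hw0 hw1).hasSum
      simpa [HasSum, PhiShort, indicator_of_mem hs] using this
    · simp [indicator_of_notMem hs]

lemma dens_hasSum (s v : ℝ) (hs : 0 < s) :
    HasSum (fun k : ℤ => (v + 2 * (k : ℝ)) * Real.exp (-(v + 2 * (k : ℝ)) ^ 2 / (4 * s)))
      (2 * HurwitzZeta.oddKernel ((v / 2 : ℝ) : UnitAddCircle) (1 / (π * s))) := by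
  have h := (HurwitzZeta.hasSum_int_oddKernel (v / 2) (x := 1 / (π * s)) (by positivity)).mul_left 2
  refine h.congr_fun fun k => ?_
  have : -(v + 2 * (k : ℝ)) ^ 2 / (4 * s) = -π * ((k:ℝ) + v / 2) ^ 2 * (1 / (π * s)) := by
    have := Real.pi_pos
    field_simp
    ring
  rw [this]; ring

lemma dens_eq (s v : ℝ) (hs : 0 < s) :
    phiDens s v = π * HurwitzZeta.sinKernel ((v / 2 : ℝ) : UnitAddCircle) (π * s) := by
  have hp := Real.pi_pos
  unfold phiDens
  rw [(dens_hasSum s v hs).tsum_eq, HurwitzZeta.oddKernel_functional_equation]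
  have h1 : (1 / (π * s)) ^ (3 / 2 : ℝ) = (√((π * s) ^ 3))⁻¹ := by
    rw [one_div, Real.inv_rpow (by positivity), Real.sqrt_eq_rpow, ← Real.rpow_natCast,
      ← Real.rpow_mul (by positivity)]
    norm_num
  have h2 : 2 * √((π * s) ^ 3) = π * √(4 * π * s ^ 3) := by
    have e1 : 2 * √((π * s) ^ 3) = √(2 ^ 2 * (π * s) ^ 3) := by
      rw [Real.sqrt_mul (by positivity), Real.sqrt_sq (by positivity)]
    have e2 : π * √(4 * π * s ^ 3) = √(π ^ 2 * (4 * π * s ^ 3)) := by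
      rw [Real.sqrt_mul (x := π ^ 2) (by positivity), Real.sqrt_sq (by positivity)]
    rw [e1, e2]; congr 1; ring
  have h3 : √(4 * π * s ^ 3) ≠ 0 := by positivity
  rw [h1, one_div, inv_inv, one_div_one_div, ← mul_assoc 2, h2]
  field_simp

lemma dens_cont (v : ℝ) : ContinuousOn (fun s => phiDens s v) (Ioi 0) := by
  have : ContinuousOn (fun s => π * HurwitzZeta.sinKernel ((v / 2 : ℝ) : UnitAddCircle) (π * s))
      (Ioi 0) := by
    apply ContinuousOn.mul continuousOn_const
    refine (HurwitzZeta.continuousOn_sinKernel _).comp (by fun_prop) ?_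
    intro s hs
    exact mul_pos Real.pi_pos hs
  exact this.congr fun s hs => dens_eq s v hs

lemma dens_meas (v : ℝ) : Measurable (indicator (Ioi 0) (fun s => phiDens s v)) := by
  have := (dens_cont v).measurable_piecewise (g := fun _ => (0:ℝ)) continuousOn_const
    measurableSet_Ioi
  rwa [← Set.piecewise_eq_indicator]

lemma dens_integrable (v s₀ : ℝ) (hs : 0 < s₀) : IntegrableOn (fun s => phiDens s v) (Ioi s₀) := by
  obtain ⟨p, hp, hO⟩ := HurwitzZeta.isBigO_atTop_sinKernel ((v / 2 : ℝ) : UnitAddCircle)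
  have ht : Tendsto (fun s : ℝ => π * s) atTop atTop :=
    Tendsto.const_mul_atTop Real.pi_pos tendsto_id
  refine integrable_of_isBigO_exp_neg (b := p * π) (mul_pos hp Real.pi_pos)
    ((dens_cont v).mono fun x hx => lt_of_lt_of_le hs hx) ?_
  have h1 := (hO.comp_tendsto ht).const_mul_left π
  refine h1.congr' ?_ ?_
  · filter_upwards [eventually_gt_atTop 0] with s hs
    rw [dens_eq s v hs]; rfl
  · refine Eventually.of_forall fun s => ?_
    simp only [Function.comp]
    congr 1; ring

lemma int_aux (v : ℝ) (hv0 : 0 < v) (hv1 : v < 1) (k : ℤ) (hk : k ≠ 0) : 0 < (k:ℝ) * (k + v) := by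
  rcases lt_or_gt_of_ne hk with h | h
  · have : (k:ℝ) ≤ -1 := by exact_mod_cast (by omega : k ≤ -1)
    nlinarith
  · have : (0:ℝ) < k := by exact_mod_cast h
    positivity

lemma dens_tendsto (v : ℝ) (hv0 : 0 < v) (hv1 : v < 1) :
    Tendsto (fun s => Real.exp (v ^ 2 / (4 * s)) *
      ∑' k : ℤ, (v + 2 * (k : ℝ)) * Real.exp (-(v + 2 * (k : ℝ)) ^ 2 / (4 * s)))
      (𝓝[>] 0) (𝓝 v) := by
  have key : ∀ s : ℝ, 0 < s → ∀ k : ℤ, Real.exp (v ^ 2 / (4 * s)) * ((v + 2 * (k : ℝ)) *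
      Real.exp (-(v + 2 * (k : ℝ)) ^ 2 / (4 * s))) =
      (v + 2 * (k : ℝ)) * Real.exp (-((k * (k + v)) * s⁻¹)) := by
    intro s hs k
    have : -((k * (k + v)) * s⁻¹) = v ^ 2 / (4 * s) + -(v + 2 * (k : ℝ)) ^ 2 / (4 * s) := by
      field_simp
      ring
    rw [this, Real.exp_add]; ring
  have hg : ∑' k : ℤ, (if k = 0 then v else 0) = v := by simp
  have hS : Summable (fun k : ℤ => (v + 2 * (k : ℝ)) * Real.exp (-((k * (k + v)) * (1:ℝ)⁻¹))) :=
    ((dens_hasSum 1 v one_pos).summable.mul_left (Real.exp (v ^ 2 / (4 * 1)))).congr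
      fun k => key 1 one_pos k
  have hmain : Tendsto (fun s : ℝ => ∑' k : ℤ, (v + 2 * (k : ℝ)) *
      Real.exp (-((k * (k + v)) * s⁻¹))) (𝓝[>] 0) (𝓝 (∑' k : ℤ, (if k = 0 then v else 0))) := by
    refine tendsto_tsum_of_dominated_convergence hS.abs ?_ ?_
    · intro k
      by_cases hk : k = 0
      · simp [hk]
      · simp only [hk, if_false]
        have h1 : Tendsto (fun s : ℝ => ((k:ℝ) * (k + v)) * s⁻¹) (𝓝[>] 0) atTop :=
          Tendsto.const_mul_atTop (int_aux v hv0 hv1 k hk) tendsto_inv_nhdsGT_zero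
        have h2 := (Real.tendsto_exp_neg_atTop_nhds_zero.comp h1).const_mul (v + 2 * (k:ℝ))
        simpa using h2
    · filter_upwards [Ioo_mem_nhdsGT (zero_lt_one' ℝ)] with s hs k
      rw [Real.norm_eq_abs, abs_mul, abs_mul, abs_of_pos (Real.exp_pos _),
        abs_of_pos (Real.exp_pos _)]
      have h0 : 0 ≤ (k:ℝ) * (k + v) := by
        by_cases hk : k = 0
        · simp [hk]
        · exact (int_aux v hv0 hv1 k hk).le
      have hs0 := hs.1
      have : (1:ℝ)⁻¹ ≤ s⁻¹ := by
        gcongr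
        exact hs.2.le
      gcongr
  rw [hg] at hmain
  refine hmain.congr' ?_
  filter_upwards [self_mem_nhdsWithin] with s hs
  rw [← tsum_mul_left]
  exact tsum_congr fun k => (key s hs k).symm

lemma seq_x_tendsto : Tendsto (fun q : ℝ => √(-Real.log q)) (𝓝[>] 0) atTop :=
  Real.tendsto_sqrt_atTop.comp (tendsto_neg_atBot_atTop.comp Real.tendsto_log_nhdsGT_zero)

lemma sq_inv (w q : ℝ) (hw : 0 < w) (hq : q ∈ Ioo (0:ℝ) 1) :
    (2 * √(w ^ 2 / (4 * (-Real.log q))))⁻¹ = √(-Real.log q) / w := by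
  have hL : 0 < -Real.log q := by have := Real.log_neg hq.1 hq.2; linarith
  have : √(w ^ 2 / (4 * (-Real.log q))) = w / (2 * √(-Real.log q)) := by
    rw [Real.sqrt_div (by positivity), Real.sqrt_sq hw.le, Real.sqrt_mul (by norm_num)]
    congr 2
    rw [show (4:ℝ) = 2 ^ 2 by norm_num, Real.sqrt_sq (by norm_num)]
  rw [this]
  have : 0 < √(-Real.log q) := Real.sqrt_pos.2 hL
  field_simp

lemma q_factor (q : ℝ) (hq : q ∈ Ioo (0:ℝ) 1) (y : ℝ) :
    y * √(π * (-Real.log q)) / q =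
      √π * √(-Real.log q) * Real.exp (√(-Real.log q) ^ 2) * y := by
  have hL : 0 < -Real.log q := by have := Real.log_neg hq.1 hq.2; linarith
  rw [Real.sq_sqrt hL.le, Real.exp_neg, Real.exp_log hq.1, Real.sqrt_mul Real.pi_pos.le]
  ring

lemma G_tendsto (w : ℝ) (hw0 : 0 < w) (hw1 : w < 1 / 2) :
    Tendsto (fun q : ℝ => (PhiShort (w ^ 2 / (4 * (-Real.log q))) w
      + PhiShort (w ^ 2 / (4 * (-Real.log q))) (1 - w)) * √(π * (-Real.log q)) / q)
      (𝓝[>] 0) (𝓝 1) := by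
  have h0 := erfc_tendsto.comp seq_x_tendsto
  have h1 := (erfc_tendsto_mul ((1 - w) / w) (by rw [one_lt_div hw0]; linarith)).comp seq_x_tendsto
  have h2 := (erfc_tendsto_mul ((2 - w) / w) (by rw [one_lt_div hw0]; linarith)).comp seq_x_tendsto
  have hl := h0.sub h2
  have hu := h0.add h1
  rw [sub_zero] at hl
  rw [add_zero] at hu
  refine tendsto_of_tendsto_of_tendsto_of_le_of_le' hl hu ?_ ?_
  all_goals
    filter_upwards [Ioo_mem_nhdsGT (zero_lt_one' ℝ)] with q hq
    have hL : 0 < -Real.log q := by have := Real.log_neg hq.1 hq.2; linarith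
    have hx : 0 < √(-Real.log q) := Real.sqrt_pos.2 hL
    have hb := phi_bounds (w ^ 2 / (4 * (-Real.log q))) w (by positivity) hw0 (by linarith)
    have hb' := phi_bounds (w ^ 2 / (4 * (-Real.log q))) (1 - w) (by positivity) (by linarith)
      (by linarith)
    rw [sq_inv w q hw0 hq] at hb hb'
    have e1 : w * (√(-Real.log q) / w) = √(-Real.log q) := by field_simp
    have e2 : (2 - w) * (√(-Real.log q) / w) = (2 - w) / w * √(-Real.log q) := by ring
    have e3 : (1 - w) * (√(-Real.log q) / w) = (1 - w) / w * √(-Real.log q) := by ring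
    rw [e1, e2] at hb
    rw [e3] at hb'
    rw [q_factor q hq]
    simp only [Function.comp]
    have hK : 0 ≤ √π * √(-Real.log q) * Real.exp (√(-Real.log q) ^ 2) := by positivity
  · rw [← mul_sub]
    exact mul_le_mul_of_nonneg_left (by linarith) hK
  · rw [← mul_add]
    exact mul_le_mul_of_nonneg_left (by linarith) hK

lemma sq_tendsto (w : ℝ) (hw0 : 0 < w) :
    Tendsto (fun q : ℝ => w ^ 2 / (4 * (-Real.log q))) (𝓝[>] 0) (𝓝[>] 0) := by
  rw [tendsto_nhdsWithin_iff]
  constructor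
  · apply Tendsto.div_atTop tendsto_const_nhds
    exact Tendsto.const_mul_atTop (by norm_num)
      (tendsto_neg_atBot_atTop.comp Real.tendsto_log_nhdsGT_zero)
  · filter_upwards [Ioo_mem_nhdsGT (zero_lt_one' ℝ)] with q hq
    have hL : 0 < -Real.log q := by have := Real.log_neg hq.1 hq.2; linarith
    exact mem_Ioi.2 (by positivity)

lemma r_tendsto (w v : ℝ) (hw0 : 0 < w) (hv0 : 0 < v) (hv1 : v < 1) :
    Tendsto (fun q : ℝ => (w ^ 2 / (4 * q * (Real.log q) ^ 2) *
      phiDens (w ^ 2 / (4 * (-Real.log q))) v) * √(π * (-Real.log q)) * q ^ (1 - (v / w) ^ 2))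
      (𝓝[>] 0) (𝓝 (v / w)) := by
  have h := ((dens_tendsto v hv0 hv1).comp (sq_tendsto w hw0)).div_const w
  refine h.congr' ?_
  filter_upwards [Ioo_mem_nhdsGT (zero_lt_one' ℝ)] with q hq
  have hL : 0 < -Real.log q := by have := Real.log_neg hq.1 hq.2; linarith
  simp only [Function.comp, phiDens]
  set S := ∑' k : ℤ, (v + 2 * (k : ℝ)) *
    Real.exp (-(v + 2 * (k : ℝ)) ^ 2 / (4 * (w ^ 2 / (4 * (-Real.log q)))))
  have hq0 := hq.1
  have e1 : q ^ (1 - (v / w) ^ 2) = q * Real.exp (v ^ 2 / (4 * (w ^ 2 / (4 * (-Real.log q))))) := by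
    rw [Real.rpow_sub hq0, Real.rpow_one, div_eq_mul_inv, Real.rpow_def_of_pos hq0,
      ← Real.exp_neg]
    congr 2
    field_simp
  rw [e1]
  set E := Real.exp (v ^ 2 / (4 * (w ^ 2 / (4 * (-Real.log q)))))
  obtain ⟨x, hx, hxL⟩ : ∃ x : ℝ, 0 < x ∧ -Real.log q = x ^ 2 :=
    ⟨√(-Real.log q), Real.sqrt_pos.2 hL, (Real.sq_sqrt hL.le).symm⟩
  have hlog : Real.log q ^ 2 = x ^ 4 := by
    have : Real.log q = - x ^ 2 := by linarith
    rw [this]; ring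
  rw [hxL, hlog]
  have e2 : √(π * x ^ 2) = √π * x := by
    rw [Real.sqrt_mul Real.pi_pos.le, Real.sqrt_sq hx.le]
  have e3 : √(4 * π * (w ^ 2 / (4 * x ^ 2)) ^ 3) = √π * (w ^ 3 / (4 * x ^ 3)) := by
    have : 4 * π * (w ^ 2 / (4 * x ^ 2)) ^ 3 = π * (w ^ 3 / (4 * x ^ 3)) ^ 2 := by
      field_simp
    rw [this, Real.sqrt_mul Real.pi_pos.le, Real.sqrt_sq (by positivity)]
  rw [e2, e3]
  have : 0 < √π := Real.sqrt_pos.2 Real.pi_pos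
  field_simp

lemma log_ratio (u : ℝ) (hu : 0 < u) :
    Tendsto (fun N : ℕ => -Real.log (√(π * Real.log N) / N * u) / Real.log N) atTop (𝓝 1) := by
  have hlogN : Tendsto (fun N : ℕ => Real.log N) atTop atTop :=
    Real.tendsto_log_atTop.comp tendsto_natCast_atTop_atTop
  have hll : Tendsto (fun x : ℝ => Real.log x / x) atTop (𝓝 0) :=
    Real.isLittleO_log_id_atTop.tendsto_div_nhds_zero
  have h1 := hll.comp hlogN
  have h2 := (tendsto_const_nhds (x := Real.log π / 2 + Real.log u)).div_atTop hlogN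
  have h3 := ((tendsto_const_nhds (x := (1:ℝ))).sub h2).sub (h1.const_mul (1 / 2))
  simp only [mul_zero, sub_zero] at h3
  refine h3.congr' ?_
  filter_upwards [hlogN.eventually_gt_atTop 0, eventually_gt_atTop 0] with N hN hN0
  have hN0' : (0:ℝ) < N := by exact_mod_cast hN0
  have hp := Real.pi_pos
  have hy : 0 < √(π * Real.log N) := Real.sqrt_pos.2 (by positivity)
  rw [Real.log_mul (by positivity) hu.ne', Real.log_div hy.ne' hN0'.ne',
    Real.log_sqrt (by positivity), Real.log_mul hp.ne' hN.ne']
  simp only [Function.comp]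
  field_simp
  ring

lemma c_tendsto : Tendsto (fun N : ℕ => √(π * Real.log N) / N) atTop (𝓝[>] 0) := by
  have hlogN : Tendsto (fun N : ℕ => Real.log N) atTop atTop :=
    Real.tendsto_log_atTop.comp tendsto_natCast_atTop_atTop
  rw [tendsto_nhdsWithin_iff]
  constructor
  · have hll : Tendsto (fun x : ℝ => Real.log x / x) atTop (𝓝 0) :=
      Real.isLittleO_log_id_atTop.tendsto_div_nhds_zero
    have h1 := (hll.comp (tendsto_natCast_atTop_atTop (R := ℝ))).const_mul π
    have h2 := h1.mul (tendsto_inv_atTop_zero.comp (tendsto_natCast_atTop_atTop (R := ℝ)))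
    have h3 := (Real.continuous_sqrt.tendsto _).comp h2
    simp only [mul_zero, Real.sqrt_zero] at h3
    refine h3.congr' ?_
    filter_upwards [eventually_gt_atTop 0] with N hN0
    have hN0' : (0:ℝ) < N := by exact_mod_cast hN0
    simp only [Function.comp]
    rw [show π * (Real.log N / N) * (N:ℝ)⁻¹ = π * Real.log N / (N:ℝ) ^ 2 by field_simp,
      Real.sqrt_div' _ (by positivity), Real.sqrt_sq hN0'.le]
  · filter_upwards [hlogN.eventually_gt_atTop 0, eventually_gt_atTop 0] with N hN hN0
    have hN0' : (0:ℝ) < N := by exact_mod_cast hN0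
    have hp := Real.pi_pos
    have hy : 0 < √(π * Real.log N) := Real.sqrt_pos.2 (by positivity)
    exact mem_Ioi.2 (by positivity)

lemma core_bound_integrable (β : ℝ) (hβ : 1 < β) (M : ℝ) :
    IntegrableOn (fun u : ℝ => M * 4 * (u ^ (β - 1) + u ^ β) * Real.exp (-(u / 4))) (Ioi 0) := by
  have h1 := integrableOn_rpow_mul_exp_neg_mul_rpow (p := 1) (s := β - 1) (b := 1 / 4)
    (by linarith) one_pos (by norm_num)
  have h2 := integrableOn_rpow_mul_exp_neg_mul_rpow (p := 1) (s := β) (b := 1 / 4)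
    (by linarith) one_pos (by norm_num)
  refine IntegrableOn.congr_fun ((h1.add h2).const_mul (M * 4)) ?_ measurableSet_Ioi
  intro u _
  simp only [Pi.add_apply, Real.rpow_one]
  rw [show -(1/4) * u = -(u / 4) by ring]
  ring

lemma core_dom (β M q₀ : ℝ) (hM : 0 ≤ M) (g r : ℝ → ℝ)
    (hq₀' : q₀ ≤ Real.exp (-1))
    (hg : ∀ q ∈ Ioo 0 q₀, q / (2 * √(π * (-Real.log q))) ≤ g q ∧ g q ≤ 1)
    (hr : ∀ q ∈ Ioo 0 q₀, |r q| ≤ M * (q ^ (β - 1) / √(π * (-Real.log q))))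
    (N : ℕ) (hN : 2 ≤ N) (h1 : 1 ≤ π * Real.log N) (h2 : π * Real.log N ≤ N)
    (u : ℝ) (hu : 0 < u) (huq : √(π * Real.log N) / N * u < q₀) :
    |√(π * Real.log N) * (√(π * Real.log N) / N) ^ (1 - β) *
      ((1 - g (√(π * Real.log N) / N * u)) ^ (N - 1) * r (√(π * Real.log N) / N * u))| ≤
    M * 4 * (u ^ (β - 1) + u ^ β) * Real.exp (-(u / 4)) := by
  have hp := Real.pi_pos
  set a := Real.log N with ha
  have ha0 : 0 < a := by
    by_contra h
    have : π * a ≤ 0 := mul_nonpos_of_nonneg_of_nonpos hp.le (not_lt.1 h)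
    linarith
  have hN0 : (0:ℝ) < N := by positivity
  have hN2 : (2:ℝ) ≤ N := by exact_mod_cast hN
  set y := √(π * a) with hy
  have hy0 : 0 < y := Real.sqrt_pos.2 (by positivity)
  set c := y / N with hc
  have hc0 : 0 < c := by positivity
  set q := c * u with hq
  have hq0 : 0 < q := by positivity
  have hqm : q ∈ Ioo 0 q₀ := ⟨hq0, huq⟩
  obtain ⟨hg1, hg2⟩ := hg q hqm
  have hr1 := hr q hqm
  set L := -Real.log q with hL
  have hL1 : 1 ≤ L := by
    have : Real.log q ≤ -1 := by
      rw [Real.log_le_iff_le_exp hq0]; linarith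
    linarith
  have hlogc : -Real.log c = a - 1 / 2 * Real.log (π * a) := by
    rw [hc, Real.log_div hy0.ne' hN0.ne', hy, Real.log_sqrt (by positivity)]
    ring
  have hA1 : -Real.log c ≤ a := by
    have := Real.log_nonneg h1
    linarith
  have hA2 : a / 2 ≤ -Real.log c := by
    have := Real.log_le_log (by linarith) h2
    linarith
  have hLu : L = -Real.log c - Real.log u := by
    rw [hL, hq, Real.log_mul hc0.ne' hu.ne']; ring
  have hsL : 0 < √(π * L) := Real.sqrt_pos.2 (by positivity)
  set ρ := y / √(π * L) with hρ
  have hρe : ρ = √(a / L) := by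
    rw [hρ, hy, ← Real.sqrt_div (by positivity)]
    congr 1; field_simp
  have hρ0 : 0 < ρ := by positivity
  have hg0 : 0 ≤ g q := le_trans (by positivity) hg1
  have hNg : u * ρ / 2 ≤ N * g q := by
    calc u * ρ / 2 = N * (q / (2 * √(π * L))) := by
          rw [hρ, hq, hc]; field_simp
      _ ≤ N * g q := by gcongr
  have hE : |(1 - g q) ^ (N - 1)| ≤ 1 := by
    rw [abs_of_nonneg (pow_nonneg (by linarith) _)]
    exact pow_le_one₀ (by linarith) (by linarith)
  have hmain : |y * c ^ (1 - β) * ((1 - g q) ^ (N - 1) * r q)| ≤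
      M * u ^ (β - 1) * ρ * |(1 - g q) ^ (N - 1)| := by
    rw [abs_mul, abs_mul, abs_mul, abs_of_pos hy0, abs_of_pos (Real.rpow_pos_of_pos hc0 _)]
    have e : c ^ (1 - β) * q ^ (β - 1) = u ^ (β - 1) := by
      rw [hq, Real.mul_rpow hc0.le hu.le, ← mul_assoc, ← Real.rpow_add hc0]
      simp
    calc y * c ^ (1 - β) * (|(1 - g q) ^ (N - 1)| * |r q|)
        ≤ y * c ^ (1 - β) * (|(1 - g q) ^ (N - 1)| * (M * (q ^ (β - 1) / √(π * L)))) := by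
          gcongr
      _ = M * (c ^ (1 - β) * q ^ (β - 1)) * (y / √(π * L)) * |(1 - g q) ^ (N - 1)| := by ring
      _ = _ := by rw [e]
  refine hmain.trans ?_
  have hub : 0 < u ^ (β - 1) := Real.rpow_pos_of_pos hu _
  have hub' : 0 < u ^ β := Real.rpow_pos_of_pos hu _
  rcases le_or_gt 1 u with hu1 | hu1
  · have hlu : 0 ≤ Real.log u := Real.log_nonneg hu1
    have hρ1 : 1 ≤ ρ := by
      rw [hρe, Real.one_le_sqrt, one_le_div (by linarith)]
      linarith
    have hρ2 : ρ ≤ 2 * u := by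
      rw [hρe, Real.sqrt_le_left (by linarith), div_le_iff₀ (by linarith)]
      have hlu2 := Real.log_le_sub_one_of_pos hu
      have k1 : a ≤ 2 * (u * L) := by
        nlinarith [mul_nonneg (sub_nonneg.2 hu1) (sub_nonneg.2 hL1)]
      have k2 : 0 ≤ u * L := by positivity
      nlinarith [mul_nonneg k2 (sub_nonneg.2 hu1)]
    have hexp : |(1 - g q) ^ (N - 1)| ≤ Real.exp (-(u / 4)) := by
      rw [abs_of_nonneg (pow_nonneg (by linarith) _)]
      calc (1 - g q) ^ (N - 1) ≤ (Real.exp (-(g q))) ^ (N - 1) :=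
            pow_le_pow_left₀ (by linarith) (Real.one_sub_le_exp_neg _) _
        _ = Real.exp (-(((N - 1 : ℕ) : ℝ) * g q)) := by
            rw [← Real.exp_nat_mul]; congr 1; ring
        _ ≤ Real.exp (-(u / 4)) := by
            apply Real.exp_le_exp.2
            have : ((N - 1 : ℕ) : ℝ) = N - 1 := by
              rw [Nat.cast_sub (by omega)]; simp
            rw [this]
            nlinarith
    have e2 : u ^ (β - 1) * u = u ^ β := by
      rw [← Real.rpow_add_one hu.ne']; simp
    calc M * u ^ (β - 1) * ρ * |(1 - g q) ^ (N - 1)|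
        ≤ M * u ^ (β - 1) * (2 * u) * Real.exp (-(u / 4)) := by gcongr
      _ = M * 2 * u ^ β * Real.exp (-(u / 4)) := by rw [← e2]; ring
      _ ≤ M * 4 * (u ^ (β - 1) + u ^ β) * Real.exp (-(u / 4)) := by
          gcongr
          · norm_num
          · linarith
  · have hlu : Real.log u ≤ 0 := Real.log_nonpos hu.le hu1.le
    have hρ2 : ρ ≤ 2 := by
      rw [hρe, Real.sqrt_le_left (by norm_num), div_le_iff₀ (by linarith)]
      linarith
    have hexp : 1 ≤ 2 * Real.exp (-(u / 4)) := by
      have := Real.one_sub_le_exp_neg (u / 4)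
      linarith
    calc M * u ^ (β - 1) * ρ * |(1 - g q) ^ (N - 1)|
        ≤ M * u ^ (β - 1) * 2 * (2 * Real.exp (-(u / 4))) := by
          gcongr; linarith
      _ = M * 4 * (u ^ (β - 1) + 0) * Real.exp (-(u / 4)) := by ring
      _ ≤ M * 4 * (u ^ (β - 1) + u ^ β) * Real.exp (-(u / 4)) := by gcongr

lemma core_lim (β b : ℝ) (g r : ℝ → ℝ)
    (hgt : Tendsto (fun q => g q * √(π * (-Real.log q)) / q) (𝓝[>] 0) (𝓝 1))
    (hrt : Tendsto (fun q => r q * √(π * (-Real.log q)) * q ^ (1 - β)) (𝓝[>] 0) (𝓝 b))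
    (u : ℝ) (hu : 0 < u) :
    Tendsto (fun N : ℕ => √(π * Real.log N) * (√(π * Real.log N) / N) ^ (1 - β) *
      ((1 - g (√(π * Real.log N) / N * u)) ^ (N - 1) * r (√(π * Real.log N) / N * u)))
      atTop (𝓝 (b * (Real.exp (-u) * u ^ (β - 1)))) := by
  have hp := Real.pi_pos
  have hlogN : Tendsto (fun N : ℕ => Real.log N) atTop atTop :=
    Real.tendsto_log_atTop.comp tendsto_natCast_atTop_atTop
  have hqt : Tendsto (fun N : ℕ => √(π * Real.log N) / N * u) atTop (𝓝[>] 0) := by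
    have := c_tendsto
    rw [tendsto_nhdsWithin_iff] at this ⊢
    refine ⟨by simpa using this.1.mul_const u, ?_⟩
    filter_upwards [this.2] with N hN
    exact mul_pos hN hu
  have hA := hgt.comp hqt
  have hB := hrt.comp hqt
  have hρ : Tendsto (fun N : ℕ => √(π * Real.log N) /
      √(π * (-Real.log (√(π * Real.log N) / N * u)))) atTop (𝓝 1) := by
    have h1 := (Real.continuous_sqrt.tendsto _).comp ((log_ratio u hu).inv₀ one_ne_zero)
    simp only [inv_one, Real.sqrt_one] at h1
    refine h1.congr' ?_
    filter_upwards [hlogN.eventually_gt_atTop 0] with N hN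
    rw [← Real.sqrt_div (by positivity)]
    simp only [Function.comp, inv_div]
    congr 1
    rw [mul_div_mul_left _ _ hp.ne']
  have hLpos : ∀ᶠ N : ℕ in atTop, 0 < -Real.log (√(π * Real.log N) / N * u) := by
    have : ∀ᶠ q : ℝ in 𝓝[>] 0, 0 < -Real.log q := by
      filter_upwards [Ioo_mem_nhdsGT (zero_lt_one' ℝ)] with q hq
      have := Real.log_neg hq.1 hq.2; linarith
    exact hqt.eventually this
  have hev : ∀ᶠ N : ℕ in atTop, 0 < Real.log N ∧ (0:ℝ) < N := by
    filter_upwards [hlogN.eventually_gt_atTop 0, eventually_gt_atTop 0] with N h1 h2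
    exact ⟨h1, by exact_mod_cast h2⟩
  -- `N g → u`
  have hNg : Tendsto (fun N : ℕ => (N:ℝ) * g (√(π * Real.log N) / N * u)) atTop (𝓝 u) := by
    have h1 := (hA.mul hρ).mul_const u
    simp only [one_mul, mul_one] at h1
    refine h1.congr' ?_
    filter_upwards [hLpos, hev] with N hL hN
    obtain ⟨hN1, hN0⟩ := hN
    have hy : 0 < √(π * Real.log N) := Real.sqrt_pos.2 (by positivity)
    have hs : 0 < √(π * (-Real.log (√(π * Real.log N) / N * u))) :=
      Real.sqrt_pos.2 (by positivity)
    simp only [Function.comp]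
    generalize g (√(π * Real.log N) / N * u) = G
    generalize √(π * (-Real.log (√(π * Real.log N) / N * u))) = S at *
    field_simp
  have hg0 : Tendsto (fun N : ℕ => g (√(π * Real.log N) / N * u)) atTop (𝓝 0) := by
    have h1 := hNg.mul (tendsto_inv_atTop_zero.comp (tendsto_natCast_atTop_atTop (R := ℝ)))
    simp only [mul_zero] at h1
    refine h1.congr' ?_
    filter_upwards [hev] with N hN
    have := hN.2
    simp only [Function.comp]
    field_simp
  have hpow : Tendsto (fun N : ℕ => (1 - g (√(π * Real.log N) / N * u)) ^ (N - 1)) atTop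
      (𝓝 (Real.exp (-u))) := by
    have h1 : Tendsto (fun N : ℕ => (1 + -g (√(π * Real.log N) / N * u)) ^ N) atTop
        (𝓝 (Real.exp (-u))) := by
      apply Real.tendsto_one_add_pow_exp_of_tendsto
      simpa using hNg.neg
    have h2 : Tendsto (fun N : ℕ => 1 + -g (√(π * Real.log N) / N * u)) atTop (𝓝 1) := by
      simpa using (tendsto_const_nhds (x := (1:ℝ))).add hg0.neg
    have h3 := h1.div h2 one_ne_zero
    simp only [div_one] at h3
    refine h3.congr' ?_
    filter_upwards [h2.eventually_ne one_ne_zero, eventually_gt_atTop 0] with N hne hN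
    simp only [Pi.div_apply]
    obtain ⟨m, rfl⟩ : ∃ m, N = m + 1 := ⟨N - 1, by omega⟩
    rw [pow_succ, mul_div_assoc, div_self hne, mul_one, sub_eq_add_neg]
    simp
  have h1 := ((hB.mul_const (u ^ (β - 1))).mul hρ).mul hpow
  have e : b * u ^ (β - 1) * 1 * Real.exp (-u) = b * (Real.exp (-u) * u ^ (β - 1)) := by ring
  rw [e] at h1
  refine h1.congr' ?_
  filter_upwards [hLpos, hev] with N hL hN
  obtain ⟨hN1, hN0⟩ := hN
  have hy : 0 < √(π * Real.log N) := Real.sqrt_pos.2 (by positivity)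
  have hs : 0 < √(π * (-Real.log (√(π * Real.log N) / N * u))) :=
    Real.sqrt_pos.2 (by positivity)
  simp only [Function.comp]
  have e2 : (√(π * Real.log N) / N * u) ^ (1 - β) * u ^ (β - 1) =
      (√(π * Real.log N) / N) ^ (1 - β) := by
    rw [Real.mul_rpow (by positivity) hu.le, mul_assoc, ← Real.rpow_add hu]
    simp
  rw [← e2]
  generalize √(π * (-Real.log (√(π * Real.log N) / N * u))) = S at *
  field_simp

lemma core (β b M q₀ : ℝ) (hβ : 1 < β) (hM : 0 ≤ M) (g r : ℝ → ℝ)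
    (hq₀ : 0 < q₀) (hq₀' : q₀ ≤ Real.exp (-1)) (hgm : Measurable g) (hrm : Measurable r)
    (hg : ∀ q ∈ Ioo 0 q₀, q / (2 * √(π * (-Real.log q))) ≤ g q ∧ g q ≤ 1)
    (hr : ∀ q ∈ Ioo 0 q₀, |r q| ≤ M * (q ^ (β - 1) / √(π * (-Real.log q))))
    (hgt : Tendsto (fun q => g q * √(π * (-Real.log q)) / q) (𝓝[>] 0) (𝓝 1))
    (hrt : Tendsto (fun q => r q * √(π * (-Real.log q)) * q ^ (1 - β)) (𝓝[>] 0) (𝓝 b)) :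
    Tendsto (fun N : ℕ => ((N : ℝ) * ∫ q in Ioo 0 q₀, (1 - g q) ^ (N - 1) * r q) /
      (√(π ^ (β - 1)) * Real.log N ^ ((β - 1) / 2) * (N : ℝ) ^ (1 - β))) atTop
      (𝓝 (b * Real.Gamma β)) := by
  have hp := Real.pi_pos
  have hlogN : Tendsto (fun N : ℕ => Real.log N) atTop atTop :=
    Real.tendsto_log_atTop.comp tendsto_natCast_atTop_atTop
  have hev : ∀ᶠ N : ℕ in atTop, 2 ≤ N ∧ 1 ≤ π * Real.log N ∧ π * Real.log N ≤ N := by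
    have h1 := (Tendsto.const_mul_atTop hp hlogN).eventually_ge_atTop 1
    have hll : Tendsto (fun x : ℝ => Real.log x / x) atTop (𝓝 0) :=
      Real.isLittleO_log_id_atTop.tendsto_div_nhds_zero
    have h2 := (hll.comp (tendsto_natCast_atTop_atTop (R := ℝ))).const_mul π
    rw [mul_zero] at h2
    filter_upwards [eventually_ge_atTop 2, h1, h2.eventually_lt_const one_pos] with N hN h1 h2
    refine ⟨hN, h1, ?_⟩
    have hN0 : (0:ℝ) < N := by positivity
    simp only [Function.comp] at h2
    rw [← mul_div_assoc, div_lt_one hN0] at h2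
    exact h2.le
  let Q : ℕ → ℝ → ℝ := fun N u => √(π * Real.log N) * (√(π * Real.log N) / N) ^ (1 - β) *
    indicator (Ioo 0 q₀) (fun q => (1 - g q) ^ (N - 1) * r q) (√(π * Real.log N) / N * u)
  have hcpos : ∀ᶠ N : ℕ in atTop, 0 < √(π * Real.log N) / N :=
    c_tendsto.eventually self_mem_nhdsWithin
  have hDCT : Tendsto (fun N => ∫ u in Ioi (0:ℝ), Q N u) atTop
      (𝓝 (∫ u in Ioi (0:ℝ), b * (Real.exp (-u) * u ^ (β - 1)))) := by
    refine tendsto_integral_filter_of_dominated_convergence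
      (fun u : ℝ => M * 4 * (u ^ (β - 1) + u ^ β) * Real.exp (-(u / 4))) ?_ ?_
      (core_bound_integrable β hβ M) ?_
    · refine Eventually.of_forall fun N => ?_
      apply Measurable.aestronglyMeasurable
      have hm : Measurable (indicator (Ioo 0 q₀) (fun q => (1 - g q) ^ (N - 1) * r q)) :=
        Measurable.indicator (by fun_prop) measurableSet_Ioo
      exact (hm.comp (measurable_const_mul _)).const_mul _
    · filter_upwards [hev, hcpos] with N hN hc
      rw [ae_restrict_iff' measurableSet_Ioi]
      refine ae_of_all _ fun u hu => ?_
      have hu : 0 < u := hu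
      by_cases hm : √(π * Real.log N) / N * u ∈ Ioo 0 q₀
      · simp only [Q, indicator_of_mem hm, Real.norm_eq_abs]
        exact core_dom β M q₀ hM g r hq₀' hg hr N hN.1 hN.2.1 hN.2.2 u hu hm.2
      · simp only [Q, indicator_of_notMem hm, mul_zero, norm_zero]
        positivity
    · rw [ae_restrict_iff' measurableSet_Ioi]
      refine ae_of_all _ fun u hu => ?_
      have hu : 0 < u := hu
      refine (core_lim β b g r hgt hrt u hu).congr' ?_
      have h1 := (c_tendsto.mono_right nhdsWithin_le_nhds).mul_const u
      rw [zero_mul] at h1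
      filter_upwards [hcpos, h1.eventually_lt_const hq₀] with N hc hlt
      have hm : √(π * Real.log N) / N * u ∈ Ioo 0 q₀ := ⟨by positivity, hlt⟩
      simp only [Q, indicator_of_mem hm]
  rw [integral_const_mul, ← Real.Gamma_eq_integral (by linarith)] at hDCT
  refine hDCT.congr' ?_
  filter_upwards [hev, hcpos] with N hN hc
  obtain ⟨hN2, hN1, -⟩ := hN
  have hN0 : (0:ℝ) < N := by positivity
  have ha : 0 < Real.log N := Real.log_pos (by exact_mod_cast (by omega : 1 < N))
  simp only [Q]
  rw [integral_const_mul, integral_comp_mul_left_Ioi _ _ hc, mul_zero,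
    setIntegral_indicator measurableSet_Ioo,
    show Ioi (0:ℝ) ∩ Ioo 0 q₀ = Ioo 0 q₀ from inter_eq_right.2 fun x hx => hx.1, smul_eq_mul]
  generalize (∫ q in Ioo 0 q₀, (1 - g q) ^ (N - 1) * r q) = J
  have e1 : √(π ^ (β - 1)) * Real.log N ^ ((β - 1) / 2) = √(π * Real.log N) ^ (β - 1) := by
    rw [Real.sqrt_eq_rpow, Real.sqrt_eq_rpow, ← Real.rpow_mul hp.le,
      ← Real.rpow_mul (by positivity), Real.mul_rpow hp.le ha.le]
    congr 2 <;> ring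
  rw [e1]
  have hy : 0 < √(π * Real.log N) := Real.sqrt_pos.2 (by positivity)
  set y := √(π * Real.log N)
  rw [Real.div_rpow hy.le hN0.le, show (1 - β) = -(β - 1) by ring, Real.rpow_neg hy.le]
  have h1 := Real.rpow_pos_of_pos hy (β - 1)
  have h2 := Real.rpow_pos_of_pos hN0 (-(β - 1))
  field_simp

lemma sig_deriv (w q : ℝ) (hq : q ∈ Ioo (0:ℝ) 1) :
    HasDerivAt (fun q => w ^ 2 / (4 * (-Real.log q))) (w ^ 2 / (4 * q * (Real.log q) ^ 2)) q := by
  have hL : Real.log q < 0 := Real.log_neg hq.1 hq.2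
  have hq0 := hq.1
  have h1 : HasDerivAt (fun q => 4 * (-Real.log q)) (4 * (-q⁻¹)) q :=
    (Real.hasDerivAt_log hq.1.ne').neg.const_mul 4
  have h2 := (hasDerivAt_const q (w ^ 2)).div h1 (by linarith)
  refine h2.congr_deriv ?_
  have : Real.log q ≠ 0 := hL.ne
  field_simp
  ring

lemma sig_inj (w q₀ : ℝ) (hw : 0 < w) (hq₀ : q₀ < 1) :
    InjOn (fun q => w ^ 2 / (4 * (-Real.log q))) (Ioo 0 q₀) := by
  intro a ha b hb hab
  have h1 : Real.log a < 0 := Real.log_neg ha.1 (ha.2.trans hq₀)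
  have h2 : Real.log b < 0 := Real.log_neg hb.1 (hb.2.trans hq₀)
  simp only at hab
  rw [div_eq_div_iff (by linarith) (by linarith)] at hab
  have hw2 : w ^ 2 ≠ 0 := by positivity
  have := mul_left_cancel₀ hw2 hab
  exact Real.log_injOn_pos ha.1 hb.1 (by linarith)

lemma sig_image (w q₀ : ℝ) (hw : 0 < w) (hq : 0 < q₀) (hq₀ : q₀ < 1) :
    (fun q => w ^ 2 / (4 * (-Real.log q))) '' (Ioo 0 q₀) =
      Ioo 0 (w ^ 2 / (4 * (-Real.log q₀))) := by
  have h0 : Real.log q₀ < 0 := Real.log_neg hq hq₀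
  ext s
  constructor
  · rintro ⟨q, hqm, rfl⟩
    have h1 : Real.log q < 0 := Real.log_neg hqm.1 (hqm.2.trans hq₀)
    have h2 : Real.log q < Real.log q₀ := Real.log_lt_log hqm.1 hqm.2
    refine ⟨div_pos (by positivity) (by linarith), ?_⟩
    exact div_lt_div_of_pos_left (by positivity) (by linarith) (by linarith)
  · rintro ⟨hs0, hs⟩
    rw [lt_div_iff₀ (by linarith)] at hs
    refine ⟨Real.exp (-(w ^ 2 / (4 * s))), ⟨Real.exp_pos _, ?_⟩, ?_⟩
    · rw [← Real.lt_log_iff_exp_lt hq, neg_lt, lt_div_iff₀ (by positivity)]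
      linarith
    · simp only [Real.log_exp]
      field_simp

lemma tail_tendsto (β ρ C : ℝ) (hβ : 1 < β) (hρ0 : 0 < ρ) (hρ1 : ρ < 1) (T : ℕ → ℝ)
    (hT : ∀ N, |T N| ≤ ρ ^ (N - 1) * C) :
    Tendsto (fun N : ℕ => ((N : ℝ) * T N) /
      (√(π ^ (β - 1)) * Real.log N ^ ((β - 1) / 2) * (N : ℝ) ^ (1 - β))) atTop (𝓝 0) := by
  have hk : 0 < √(π ^ (β - 1)) := Real.sqrt_pos.2 (Real.rpow_pos_of_pos Real.pi_pos _)
  have hlogN : Tendsto (fun N : ℕ => Real.log N) atTop atTop :=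
    Real.tendsto_log_atTop.comp tendsto_natCast_atTop_atTop
  obtain ⟨m, hm⟩ := exists_nat_ge β
  have h := (tendsto_pow_const_mul_const_pow_of_abs_lt_one m
    (by rwa [abs_of_pos hρ0] : |ρ| < 1)).mul_const (C / ρ / √(π ^ (β - 1)))
  rw [zero_mul] at h
  refine squeeze_zero_norm' ?_ h
  filter_upwards [hlogN.eventually_ge_atTop 1, eventually_ge_atTop 1] with N hl hN
  have hN1 : (1:ℝ) ≤ N := by exact_mod_cast hN
  have hN0 : (0:ℝ) < N := by linarith
  have hlp : 1 ≤ Real.log N ^ ((β - 1) / 2) := Real.one_le_rpow hl (by linarith)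
  have hNp := Real.rpow_pos_of_pos hN0 (1 - β)
  have hlp0 : 0 < Real.log N ^ ((β - 1) / 2) := by linarith
  have hden : 0 < √(π ^ (β - 1)) * Real.log N ^ ((β - 1) / 2) * (N:ℝ) ^ (1 - β) := by positivity
  rw [Real.norm_eq_abs, abs_div, abs_mul, abs_of_pos hN0, abs_of_pos hden]
  have e1 : ρ ^ (N - 1) = ρ ^ N / ρ := by
    obtain ⟨j, rfl⟩ : ∃ j, N = j + 1 := ⟨N - 1, by omega⟩
    rw [pow_succ]; field_simp; simp
  have e2 : (N:ℝ) / (N : ℝ) ^ (1 - β) ≤ (N:ℝ) ^ m := by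
    rw [← Real.rpow_one_sub' hN0.le (by linarith), ← Real.rpow_natCast]
    apply Real.rpow_le_rpow_of_exponent_le hN1
    linarith
  have hTN := hT N
  have hC : 0 ≤ ρ ^ (N - 1) * C := (abs_nonneg _).trans hTN
  calc (N:ℝ) * |T N| / (√(π ^ (β - 1)) * Real.log N ^ ((β - 1) / 2) * (N : ℝ) ^ (1 - β))
      ≤ (N:ℝ) * (ρ ^ (N - 1) * C) / (√(π ^ (β - 1)) * 1 * (N : ℝ) ^ (1 - β)) := by
        gcongr
    _ = (N:ℝ) / (N : ℝ) ^ (1 - β) * ((ρ ^ (N - 1) * C) / √(π ^ (β - 1))) := by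
        field_simp
    _ ≤ (N:ℝ) ^ m * ((ρ ^ (N - 1) * C) / √(π ^ (β - 1))) := by
        gcongr
    _ = (N:ℝ) ^ m * ρ ^ N * (C / ρ / √(π ^ (β - 1))) := by rw [e1]; ring

lemma main_s (w : ℝ) (hw0 : 0 < w) (hw1 : w < 1 / 2) :
    Tendsto (fun N : ℕ => ((N : ℝ) * ∫ s in Ioi (0:ℝ),
      (1 - (PhiShort s w + PhiShort s (1 - w))) ^ (N - 1) * phiDens s (1 - w)) /
      (√(π ^ (((1 - w) / w) ^ 2 - 1)) * Real.log N ^ ((((1 - w) / w) ^ 2 - 1) / 2) *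
        (N : ℝ) ^ (1 - ((1 - w) / w) ^ 2))) atTop
      (𝓝 ((1 - w) / w * Real.Gamma (((1 - w) / w) ^ 2))) := by
  have hp := Real.pi_pos
  set b := (1 - w) / w with hb
  have hb1 : 1 < b := by rw [hb, one_lt_div hw0]; linarith
  set β := b ^ 2 with hβdef
  have hβ : 1 < β := by rw [hβdef]; nlinarith
  set σ : ℝ → ℝ := fun q => w ^ 2 / (4 * (-Real.log q)) with hσ
  set σ' : ℝ → ℝ := fun q => w ^ 2 / (4 * q * (Real.log q) ^ 2) with hσ'
  set Gt : ℝ → ℝ := fun s => indicator (Ioi 0) (fun s => PhiShort s w) s +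
    indicator (Ioi 0) (fun s => PhiShort s (1 - w)) s with hGt
  set pt : ℝ → ℝ := indicator (Ioi 0) (fun s => phiDens s (1 - w)) with hpt
  have hGm : Measurable Gt :=
    (phi_meas w hw0 (by linarith)).add (phi_meas (1 - w) (by linarith) (by linarith))
  have hpm : Measurable pt := dens_meas (1 - w)
  have hGe : ∀ s, 0 < s → Gt s = PhiShort s w + PhiShort s (1 - w) := by
    intro s hs
    simp [hGt, indicator_of_mem (mem_Ioi.2 hs)]
  have hpe : ∀ s, 0 < s → pt s = phiDens s (1 - w) := by
    intro s hs
    simp [hpt, indicator_of_mem (mem_Ioi.2 hs)]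
  have hσm : Measurable σ := by
    have := Real.measurable_log
    fun_prop
  have hσm' : Measurable σ' := by
    have := Real.measurable_log
    fun_prop
  have hint : ∀ N : ℕ, ∫ s in Ioi (0:ℝ),
      (1 - (PhiShort s w + PhiShort s (1 - w))) ^ (N - 1) * phiDens s (1 - w) =
      ∫ s in Ioi (0:ℝ), (1 - Gt s) ^ (N - 1) * pt s := by
    intro N
    refine setIntegral_congr_fun measurableSet_Ioi fun s hs => ?_
    simp only [hGe s hs, hpe s hs]
  simp only [hint]
  set g : ℝ → ℝ := fun q => Gt (σ q) with hgdef
  set r : ℝ → ℝ := fun q => σ' q * pt (σ q) with hrdef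
  have hgm : Measurable g := hGm.comp hσm
  have hrm : Measurable r := hσm'.mul (hpm.comp hσm)
  have hσpos : ∀ q ∈ Ioo (0:ℝ) 1, 0 < σ q := by
    intro q hq
    have := Real.log_neg hq.1 hq.2
    exact div_pos (by positivity) (by linarith)
  have hgt : Tendsto (fun q => g q * √(π * (-Real.log q)) / q) (𝓝[>] 0) (𝓝 1) := by
    refine (G_tendsto w hw0 hw1).congr' ?_
    filter_upwards [Ioo_mem_nhdsGT (zero_lt_one' ℝ)] with q hq
    simp only [hgdef]
    rw [hGe _ (hσpos q hq)]
  have hrt : Tendsto (fun q => r q * √(π * (-Real.log q)) * q ^ (1 - β)) (𝓝[>] 0) (𝓝 b) := by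
    refine (r_tendsto w (1 - w) hw0 (by linarith) (by linarith)).congr' ?_
    filter_upwards [Ioo_mem_nhdsGT (zero_lt_one' ℝ)] with q hq
    simp only [hrdef]
    rw [hpe _ (hσpos q hq)]
  -- choice of the cut-off
  have hev : ∀ᶠ q : ℝ in 𝓝[>] 0, q ∈ Ioo (0:ℝ) (Real.exp (-1)) ∧
      (1 / 2 < g q * √(π * (-Real.log q)) / q) ∧ (g q * √(π * (-Real.log q)) / q < 2) ∧
      |r q * √(π * (-Real.log q)) * q ^ (1 - β)| < b + 1 := by
    filter_upwards [Ioo_mem_nhdsGT (Real.exp_pos (-1)), hgt.eventually_const_lt (by norm_num : (1 / 2 : ℝ) < 1),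
      hgt.eventually_lt_const (by norm_num : (1 : ℝ) < 2),
      hrt.abs.eventually_lt_const (show |b| < b + 1 by rw [abs_of_pos (by linarith)]; linarith)] with q h1 h2 h3 h4
    exact ⟨h1, h2, h3, h4⟩
  obtain ⟨q₁, hq₁, hsub⟩ := mem_nhdsGT_iff_exists_Ioo_subset.1 hev
  have hq₁ : 0 < q₁ := hq₁
  obtain ⟨q₀, hq₀, hq₀1, hq₀e⟩ : ∃ q₀ : ℝ, 0 < q₀ ∧ q₀ ≤ q₁ ∧ q₀ ≤ Real.exp (-1) :=
    ⟨min q₁ (Real.exp (-1)), lt_min hq₁ (Real.exp_pos _), min_le_left _ _, min_le_right _ _⟩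
  have hexp2 : Real.exp (-1) < 1 / 2 := by
    have := Real.exp_neg_one_lt_d9
    linarith
  have hq₀lt : q₀ < 1 := by linarith
  have hall : ∀ q ∈ Ioo 0 q₀, q < 1 / 2 ∧ 1 ≤ √(π * (-Real.log q)) ∧
      q / (2 * √(π * (-Real.log q))) ≤ g q ∧ g q ≤ 1 ∧
      |r q| ≤ (b + 1) * (q ^ (β - 1) / √(π * (-Real.log q))) := by
    intro q hq
    obtain ⟨h1, h2, h3, h4⟩ := hsub ⟨hq.1, hq.2.trans_le hq₀1⟩
    have hq0 := hq.1
    have hL : 1 < -Real.log q := by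
      have : Real.log q < -1 := by rw [Real.log_lt_iff_lt_exp hq0]; exact h1.2
      linarith
    have hS : 1 ≤ √(π * (-Real.log q)) := by
      rw [Real.one_le_sqrt]
      nlinarith [Real.pi_gt_three]
    set S := √(π * (-Real.log q))
    have hS0 : 0 < S := by linarith
    have hq2 : q < 1 / 2 := h1.2.trans hexp2
    refine ⟨hq2, hS, ?_, ?_, ?_⟩
    · rw [lt_div_iff₀ hq0] at h2
      rw [div_le_iff₀ (by positivity)]
      linarith
    · rw [div_lt_iff₀ hq0] at h3
      by_contra hcon
      nlinarith
    · have hqp := Real.rpow_pos_of_pos hq0 (1 - β)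
      rw [abs_mul, abs_mul, abs_of_pos hS0, abs_of_pos hqp] at h4
      rw [show β - 1 = -(1 - β) by ring, Real.rpow_neg hq0.le]
      rw [inv_div_left, ← div_eq_mul_inv, le_div_iff₀ (by positivity)]
      linarith
  have hcore := core β b (b + 1) q₀ hβ (by linarith) g r hq₀ hq₀e hgm hrm
    (fun q hq => ⟨(hall q hq).2.2.1, (hall q hq).2.2.2.1⟩)
    (fun q hq => (hall q hq).2.2.2.2) hgt hrt
  set s₀ := σ q₀ with hs₀
  have hs₀pos : 0 < s₀ := hσpos q₀ ⟨hq₀, hq₀lt⟩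
  have himg : σ '' (Ioo 0 q₀) = Ioo 0 s₀ := sig_image w q₀ hw0 hq₀ hq₀lt
  have hinj : InjOn σ (Ioo 0 q₀) := sig_inj w q₀ hw0 hq₀lt
  have hder : ∀ q ∈ Ioo 0 q₀, HasDerivWithinAt σ (σ' q) (Ioo 0 q₀) q := fun q hq =>
    (sig_deriv w q ⟨hq.1, hq.2.trans hq₀lt⟩).hasDerivWithinAt
  have hσ'nn : ∀ q ∈ Ioo 0 q₀, |σ' q| = σ' q := by
    intro q hq
    have := hq.1
    exact abs_of_nonneg (by positivity)
  have hint1 : ∀ N : ℕ, ∫ s in Ioo 0 s₀, (1 - Gt s) ^ (N - 1) * pt s =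
      ∫ q in Ioo 0 q₀, (1 - g q) ^ (N - 1) * r q := by
    intro N
    rw [← himg, integral_image_eq_integral_abs_deriv_smul measurableSet_Ioo hder hinj]
    refine setIntegral_congr_fun measurableSet_Ioo fun q hq => ?_
    simp only [hσ'nn q hq, smul_eq_mul, hgdef, hrdef]
    ring
  have hio1 : ∀ N : ℕ, IntegrableOn (fun s => (1 - Gt s) ^ (N - 1) * pt s) (Ioo 0 s₀) := by
    intro N
    rw [← himg, integrableOn_image_iff_integrableOn_abs_deriv_smul measurableSet_Ioo hder hinj]
    have h1 : IntegrableOn (fun q => (1 - g q) ^ (N - 1) * r q) (Ioo 0 q₀) := by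
      refine Measure.integrableOn_of_bounded (M := b + 1) (by simp)
        (Measurable.aestronglyMeasurable (by fun_prop)) ?_
      rw [ae_restrict_iff' measurableSet_Ioo]
      refine ae_of_all _ fun q hq => ?_
      obtain ⟨h1, h2, h3, h4, h5⟩ := hall q hq
      have hq0 := hq.1
      have hg0 : 0 ≤ g q := le_trans (by positivity) h3
      rw [norm_mul, Real.norm_eq_abs, Real.norm_eq_abs]
      have hE : |(1 - g q) ^ (N - 1)| ≤ 1 := by
        rw [abs_of_nonneg (pow_nonneg (by linarith) _)]
        exact pow_le_one₀ (by linarith) (by linarith)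
      have h6 : q ^ (β - 1) ≤ 1 := Real.rpow_le_one hq0.le (by linarith) (by linarith)
      have h7 : q ^ (β - 1) / √(π * (-Real.log q)) ≤ 1 := by
        rw [div_le_one (by linarith)]; linarith
      calc |(1 - g q) ^ (N - 1)| * |r q| ≤ 1 * ((b + 1) * 1) := by
            gcongr
            exact h5.trans (by gcongr)
        _ = b + 1 := by ring
    refine h1.congr_fun ?_ measurableSet_Ioo
    intro q hq
    simp only [hσ'nn q hq, smul_eq_mul, hgdef, hrdef]
    ring
  -- the tail
  obtain ⟨ρ, hρ0, hρ1, hρ⟩ : ∃ ρ : ℝ, 0 < ρ ∧ ρ < 1 ∧ ∀ s ∈ Ici s₀, |1 - Gt s| ≤ ρ := by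
    have hd := erfc_pos (w * (2 * √s₀)⁻¹)
    have hw2 : 0 < w / (2 - w) := div_pos hw0 (by linarith)
    have hw3 : w / (2 - w) < 1 := by rw [div_lt_one (by linarith)]; linarith
    refine ⟨max (1 - (1 - w) * erfc (w * (2 * √s₀)⁻¹)) (1 - w / (2 - w)),
      lt_max_of_lt_right (by linarith), max_lt ?_ (by linarith), ?_⟩
    · have : 0 < (1 - w) * erfc (w * (2 * √s₀)⁻¹) := mul_pos (by linarith) hd
      linarith
    · intro s hs
      have hs : s₀ ≤ s := hs
      have hs0 : 0 < s := lt_of_lt_of_le hs₀pos hs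
      rw [hGe s hs0]
      have h1 := phi_bounds s w hs0 hw0 (by linarith)
      have h2 := phi_bounds s (1 - w) hs0 (by linarith) (by linarith)
      have h3 : erfc (w * (2 * √s₀)⁻¹) ≤ erfc (w * (2 * √s)⁻¹) := by
        apply erfc_strictAnti.antitone
        gcongr
      have h4 : (1 - w) * erfc (w * (2 * √s₀)⁻¹) ≤ (1 - w) * erfc (w * (2 * √s)⁻¹) :=
        mul_le_mul_of_nonneg_left h3 (by linarith)
      have h5 : 0 ≤ (1 - w) / (2 - (1 - w)) := div_nonneg (by linarith) (by linarith)
      rw [abs_le]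
      constructor
      · have := le_max_right (1 - (1 - w) * erfc (w * (2 * √s₀)⁻¹)) (1 - w / (2 - w))
        linarith [h1.2.1, h2.2.1]
      · have := le_max_left (1 - (1 - w) * erfc (w * (2 * √s₀)⁻¹)) (1 - w / (2 - w))
        linarith [h1.2.2.1, h2.2.2.2.2]
  have hpi : IntegrableOn pt (Ici s₀) := by
    rw [integrableOn_Ici_iff_integrableOn_Ioi]
    exact (dens_integrable (1 - w) s₀ hs₀pos).congr_fun
      (fun s hs => (hpe s (hs₀pos.trans hs)).symm) measurableSet_Ioi
  have hbd : ∀ N : ℕ, ∀ᵐ s ∂(volume.restrict (Ici s₀)),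
      ‖(1 - Gt s) ^ (N - 1) * pt s‖ ≤ ρ ^ (N - 1) * ‖pt s‖ := by
    intro N
    rw [ae_restrict_iff' measurableSet_Ici]
    refine ae_of_all _ fun s hs => ?_
    rw [norm_mul, norm_pow, Real.norm_eq_abs (1 - Gt s)]
    gcongr
    exact hρ s hs
  have hio2 : ∀ N : ℕ, IntegrableOn (fun s => (1 - Gt s) ^ (N - 1) * pt s) (Ici s₀) := by
    intro N
    exact Integrable.mono' (hpi.norm.const_mul (ρ ^ (N - 1)))
      (Measurable.aestronglyMeasurable (by fun_prop)) (hbd N)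
  have htail := tail_tendsto β ρ (∫ s in Ici s₀, ‖pt s‖) hβ hρ0 hρ1
    (fun N => ∫ s in Ici s₀, (1 - Gt s) ^ (N - 1) * pt s) (fun N => by
      rw [← integral_const_mul]
      exact norm_integral_le_of_norm_le (hpi.norm.const_mul (ρ ^ (N - 1))) (hbd N))
  have hsum := hcore.add htail
  rw [add_zero] at hsum
  refine hsum.congr fun N => ?_
  rw [← add_div, ← mul_add, ← hint1 N, ← setIntegral_union ?_ measurableSet_Ici (hio1 N) (hio2 N),
    Ioo_union_Ici_eq_Ioi hs₀pos]
  rw [Set.disjoint_left]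
  intro x hx hx'
  exact absurd hx.2 (not_lt.2 hx')

/-- **Extreme hitting probability asymptotics for pure diffusion on `(0, l)`.**
With `F` the exit-time distribution function and `f₁` the density of hitting `l` by time `t`,
`N ∫_0^∞ (1-F(t))^{N-1} f₁(t) dt ∼ η (ln N)^{(β-1)/2} N^{1-β}` as `N → ∞`, where
`β = ((l-x₀)/x₀)² > 1` and `η = √(β π^{β-1}) Γ(β) > 0`. -/
theorem extreme_hitting_asymptotics_interval
    (D l x₀ : ℝ) (hD : 0 < D) (hl : 0 < l) (hx₀ : 0 < x₀) (hx₀l : x₀ < l / 2)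
    (F f₁ : ℝ → ℝ)
    (hF : ∀ t : ℝ, F t = PhiShort (D * t / l ^ 2) (x₀ / l)
        + PhiShort (D * t / l ^ 2) (1 - x₀ / l))
    (hf₁ : ∀ t : ℝ, f₁ t = D / l ^ 2 * phiDens (D * t / l ^ 2) (1 - x₀ / l))
    (β η : ℝ) (hβ : β = ((l - x₀) / x₀) ^ 2)
    (hη : η = Real.sqrt (β * Real.pi ^ (β - 1)) * Real.Gamma β) :
    1 < β ∧ 0 < η ∧
      Tendsto
        (fun N : ℕ =>
          ((N : ℝ) * ∫ t in Ioi (0 : ℝ), (1 - F t) ^ (N - 1) * f₁ t) /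
            (η * Real.log N ^ ((β - 1) / 2) * (N : ℝ) ^ (1 - β)))
        atTop (𝓝 1) := by
  have hp := Real.pi_pos
  set w := x₀ / l with hw
  have hw0 : 0 < w := by positivity
  have hw1 : w < 1 / 2 := by rw [hw, div_lt_iff₀ hl]; linarith
  have hbe : (1 - w) / w = (l - x₀) / x₀ := by rw [hw]; field_simp
  have hb1 : 1 < (1 - w) / w := by rw [one_lt_div hw0]; linarith
  have hβ' : β = ((1 - w) / w) ^ 2 := by rw [hbe, hβ]
  have hβ1 : 1 < β := by rw [hβ']; nlinarith
  have hG : 0 < Real.Gamma β := Real.Gamma_pos_of_pos (by linarith)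
  have hk : 0 < π ^ (β - 1) := Real.rpow_pos_of_pos hp _
  have hη0 : 0 < η := by
    rw [hη]
    exact mul_pos (Real.sqrt_pos.2 (mul_pos (by linarith) hk)) hG
  refine ⟨hβ1, hη0, ?_⟩
  have hηe : η = (1 - w) / w * Real.Gamma β * √(π ^ (β - 1)) := by
    rw [hη, Real.sqrt_mul (by linarith), show √β = (1 - w) / w by
      rw [hβ', Real.sqrt_sq (by linarith)]]
    ring
  have hm := main_s w hw0 hw1
  rw [← hβ'] at hm
  have hb0 : (1 - w) / w * Real.Gamma β ≠ 0 := mul_ne_zero (by linarith) hG.ne'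
  have hm2 := hm.div_const ((1 - w) / w * Real.Gamma β)
  rw [div_self hb0] at hm2
  refine hm2.congr fun N => ?_
  have hc : 0 < D / l ^ 2 := by positivity
  have hI : ∫ t in Ioi (0 : ℝ), (1 - F t) ^ (N - 1) * f₁ t = ∫ s in Ioi (0:ℝ),
      (1 - (PhiShort s w + PhiShort s (1 - w))) ^ (N - 1) * phiDens s (1 - w) := by
    have h1 := integral_comp_mul_left_Ioi (fun s =>
      (1 - (PhiShort s w + PhiShort s (1 - w))) ^ (N - 1) * phiDens s (1 - w)) 0 hc
    rw [mul_zero, smul_eq_mul] at h1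
    have h2 : ∀ J K : ℝ, J = (D / l ^ 2)⁻¹ * K → K = D / l ^ 2 * J := by
      intro J K h
      rw [h]; field_simp
    rw [h2 _ _ h1, ← integral_const_mul]
    congr 1
    funext t
    rw [hF, hf₁, show D * t / l ^ 2 = D / l ^ 2 * t by ring]
    ring
  rw [hI, hηe, div_div]
  congr 1
  ring
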